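/- Let α ≥ 1 and x₀ > 0 be fixed, and write D^p(y^α) for the p-th derivative of y ↦ y^α, i.e. D^p(y^α)(y) = α(α−1)⋯(α−p+1) y^(α−p). Then the limit as θ → 0⁺ of R_{x₀}/θ exists and equals (2i)^(−1) · [ e^(−2ix₀) · Σ_{p=2}^{⌊α⌋+1} (2i)^(−(p+1)) D^p(y^α)(x₀) + (2i)^(−(⌊α⌋+2)) ∫_{x₀}^∞ e^(−2iy) D^(⌊α⌋+2)(y^α)(y) dy ]. -/

import Mathlib

open MeasureTheory Set Filter Topology

noncomputable section

/-- The wave speed profile `c(x) = (1 + θ (x₊)^α)^(-1/2)`. -/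
def spd (α θ x : ℝ) : ℝ := (1 + θ * (max x 0) ^ α) ^ (-(1 / 2) : ℝ)

/-- The WKB amplitude `b(x) = c(x)^(1/2)`. -/
def amp (α θ x : ℝ) : ℝ := spd α θ x ^ ((1 : ℝ) / 2)

/-- The WKB phase `φ(x) = ∫₀ˣ c(y)⁻¹ dy`. -/
def phase (α θ x : ℝ) : ℝ := ∫ y in (0:ℝ)..x, (spd α θ y)⁻¹

/-- `M(x) = c(x)^(1/2) (c^(1/2))''(x)` for `x > 0`, and `0` for `x ≤ 0`. -/
def Mfun (α θ x : ℝ) : ℝ :=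
  if 0 < x then
    spd α θ x ^ ((1 : ℝ) / 2) * deriv (deriv (fun y => spd α θ y ^ ((1 : ℝ) / 2))) x
  else 0

/-- `M_{x₀} = ∫_{x₀}^∞ |M(x)| dx`. -/
def Mtail (α θ x₀ : ℝ) : ℝ := ∫ x in Ioi x₀, |Mfun α θ x|

/-- The Volterra operator `K_σ`. -/
def Kop (α θ x₀ σ : ℝ) (f : ℝ → ℂ) (x : ℝ) : ℂ :=
  (2 * Complex.I * (1 + Complex.I * (σ : ℂ)))⁻¹ *
    ((∫ y in x₀..x, (Mfun α θ y : ℂ) * f y *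
        Complex.exp (-2 * Complex.I * (1 + Complex.I * (σ : ℂ)) *
          ((phase α θ x - phase α θ y : ℝ) : ℂ))) +
      ∫ y in Ioi x, (Mfun α θ y : ℂ) * f y)

/-- The right-going WKB wave `v^> = b e^{-iφ}`. -/
def vplus (α θ x : ℝ) : ℂ := (amp α θ x : ℂ) * Complex.exp (-Complex.I * (phase α θ x : ℂ))

/-- The left-going WKB wave `v^< = b e^{iφ}`. -/
def vminus (α θ x : ℝ) : ℂ := (amp α θ x : ℂ) * Complex.exp (Complex.I * (phase α θ x : ℂ))

/-- `S` is a bounded continuous solution on `[x₀,∞)` of `S = e^{-2iφ} + K₀ S`. -/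
def IsVolterraSol (α θ x₀ : ℝ) (S : ℝ → ℂ) : Prop :=
  (∃ C, ∀ x ∈ Ici x₀, ‖S x‖ ≤ C) ∧ ContinuousOn S (Ici x₀) ∧
    ∀ x ∈ Ici x₀, S x = Complex.exp (-2 * Complex.I * (phase α θ x : ℂ)) + Kop α θ x₀ 0 S x

/-- `R_{x₀} = (2i)⁻¹ ∫_{x₀}^∞ M S^>`. -/
def Rx (α θ x₀ : ℝ) (S : ℝ → ℂ) : ℂ :=
  (2 * Complex.I)⁻¹ * ∫ x in Ioi x₀, (Mfun α θ x : ℂ) * S x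

/-- `dcoef α p = α(α-1)⋯(α-p+1)`, the coefficient of the `p`-th derivative of `y^α`. -/
def dcoef (α : ℝ) (p : ℕ) : ℝ := ∏ j ∈ Finset.range p, (α - j)

section RiccatiPolynomials

open MvPolynomial

/-- The algebraic form of `y ∂_y` on polynomials in `W = c(y)` and `Z = 1/y`. -/
def eulerDer (α : ℝ) : Derivation ℂ (MvPolynomial (Fin 2) ℂ) (MvPolynomial (Fin 2) ℂ) :=
  mkDerivation ℂ ![-C ((α : ℂ) / 2) * X 0 * (1 - X 0 ^ 2), -X 1]

/-- The potential `M` as a polynomial in `W = c(y)` and `Z = 1/y`, divided by `(1 - W²) Z²`. -/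
def potFactor (α : ℝ) : MvPolynomial (Fin 2) ℂ :=
  X 0 * (C ((α : ℂ) / 4) + C ((α : ℂ) ^ 2 / 16) * (1 - X 0 ^ 2) - C ((α : ℂ) ^ 2 / 4) * X 0 ^ 2)

/-- The potential `M` as a polynomial in `W = c(y)` and `Z = 1/y`. -/
def potPoly (α : ℝ) : MvPolynomial (Fin 2) ℂ := (1 - X 0 ^ 2) * X 1 ^ 2 * potFactor α

/-- The left side of the Riccati equation satisfied by the reflection amplitude,
multiplied by `W`. -/
def riccati (α : ℝ) (r : MvPolynomial (Fin 2) ℂ) : MvPolynomial (Fin 2) ℂ :=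
  X 0 * X 1 * eulerDer α r - C (2 * Complex.I) * r -
    X 0 * (C (2 * Complex.I)⁻¹ * potPoly α) * (r - 1) ^ 2

lemma eulerDer_X0 (α : ℝ) : eulerDer α (X 0) = -C ((α : ℂ) / 2) * X 0 * (1 - X 0 ^ 2) := by
  simp [eulerDer, mkDerivation_X]

lemma eulerDer_X1 (α : ℝ) : eulerDer α (X 1) = -X 1 := by
  simp [eulerDer, mkDerivation_X]

lemma eulerDer_one_sub_sq (α : ℝ) :
    eulerDer α (1 - X 0 ^ 2) = C (α : ℂ) * X 0 ^ 2 * (1 - X 0 ^ 2) := by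
  have h : (C (α : ℂ) : MvPolynomial (Fin 2) ℂ) = 2 * C ((α : ℂ) / 2) := by
    rw [show (2 : MvPolynomial (Fin 2) ℂ) = C 2 from (map_ofNat C 2).symm, ← C_mul]
    congr 1; ring
  rw [map_sub, Derivation.leibniz_pow, Derivation.map_one_eq_zero, eulerDer_X0, h]
  simp only [smul_eq_mul, nsmul_eq_mul]
  push_cast
  ring

lemma eulerDer_X1_pow (α : ℝ) (k : ℕ) :
    eulerDer α (X 1 ^ k) = -(k : MvPolynomial (Fin 2) ℂ) * X 1 ^ k := by
  rcases k with _ | k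
  · simp
  · rw [Derivation.leibniz_pow, eulerDer_X1]
    simp only [smul_eq_mul, nsmul_eq_mul, Nat.add_sub_cancel]
    ring

lemma dvd_eulerDer (α : ℝ) {f : MvPolynomial (Fin 2) ℂ} (hf : (1 - X 0) ∣ f) :
    (1 - X 0) ∣ eulerDer α f := by
  obtain ⟨g, rfl⟩ := hf
  rw [Derivation.leibniz, map_sub, Derivation.map_one_eq_zero, eulerDer_X0]
  refine dvd_add (dvd_mul_right _ _) ⟨g * C ((α : ℂ) / 2) * X 0 * (1 + X 0), ?_⟩
  simp only [smul_eq_mul]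
  ring

/-- Polynomial approximate solutions of the Riccati equation to arbitrary order in `1/y`. -/
theorem exists_riccati_approx (α : ℝ) (n : ℕ) : ∃ G H : MvPolynomial (Fin 2) ℂ,
    (1 - X 0) ∣ G - C (-((2 * Complex.I) ^ (n + 3))⁻¹ * (dcoef α (n + 2) : ℂ)) ∧
    (1 - X 0) ∣ H - ∑ j ∈ Finset.range n,
      C (-((2 * Complex.I) ^ (j + 4))⁻¹ * (dcoef α (j + 2) : ℂ)) * X 1 ^ j ∧
    riccati α ((1 - X 0 ^ 2) * X 1 ^ 2 * H) = X 0 * ((1 - X 0 ^ 2) * X 1 ^ (n + 2) * G) := by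
  have h2 : (C (2 * Complex.I) : MvPolynomial (Fin 2) ℂ) * C (2 * Complex.I)⁻¹ = 1 := by
    rw [← C_mul, mul_inv_cancel₀ (by simp), C_1]
  have hsq : (1 - X 0 : MvPolynomial (Fin 2) ℂ) ∣ 1 - X 0 ^ 2 := ⟨1 + X 0, by ring⟩
  induction n with
  | zero =>
    refine ⟨-(C (2 * Complex.I)⁻¹ * potFactor α), 0, ?_, by simp, ?_⟩
    · have hd : C (-((2 * Complex.I) ^ (0 + 3))⁻¹ * (dcoef α (0 + 2) : ℂ)) =
          -(C (2 * Complex.I)⁻¹ * (C ((α : ℂ) / 4) - C ((α : ℂ) ^ 2 / 4)) :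
            MvPolynomial (Fin 2) ℂ) := by
        rw [← C_sub, ← C_mul, ← C_neg]
        congr 1
        simp only [dcoef, Finset.prod_range_succ, Finset.prod_range_zero]
        push_cast
        have : (2 * Complex.I) ^ (0 + 3) = -4 * (2 * Complex.I) := by
          ring_nf; simp
        rw [this, mul_inv]
        ring
      rw [hd, potFactor]
      refine ⟨C (2 * Complex.I)⁻¹ * (C ((α : ℂ) / 4) - C ((α : ℂ) ^ 2 / 4) * (1 + X 0 + X 0 ^ 2)
        - X 0 * C ((α : ℂ) ^ 2 / 16) * (1 + X 0)), ?_⟩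
      ring
    · simp only [riccati, potPoly, mul_zero, map_zero]
      ring
  | succ n ih =>
    obtain ⟨G, H, hG, hH, hr⟩ := ih
    set g : ℂ := -((2 * Complex.I) ^ (n + 3))⁻¹ * (dcoef α (n + 2) : ℂ) with hg
    set E := C (2 * Complex.I)⁻¹ * X 0 * G with hE
    set r := (1 - X 0 ^ 2) * X 1 ^ 2 * H with hrdef
    set H' := H + X 1 ^ n * E with hH'
    set r' := (1 - X 0 ^ 2) * X 1 ^ 2 * H' with hr'
    have hrr : r' = r + (1 - X 0 ^ 2) * X 1 ^ (n + 2) * E := by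
      rw [hr', hH', hrdef]; ring
    have hED : (1 - X 0) ∣ E - C ((2 * Complex.I)⁻¹ * g) := by
      have : E - C ((2 * Complex.I)⁻¹ * g) =
          C (2 * Complex.I)⁻¹ * X 0 * (G - C g) - (1 - X 0) * (C (2 * Complex.I)⁻¹ * C g) := by
        rw [hE, C_mul]; ring
      rw [this]
      exact dvd_sub (hG.mul_left _) (dvd_mul_right _ _)
    refine ⟨C (α : ℂ) * X 0 ^ 2 * E - ((n : MvPolynomial (Fin 2) ℂ) + 2) * E + eulerDer α E -
      X 1 * (1 - X 0 ^ 2) * (C (2 * Complex.I)⁻¹ * potFactor α) * E * (r' + r - 2), H', ?_, ?_, ?_⟩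
    · have hg' : C (-((2 * Complex.I) ^ (n + 1 + 3))⁻¹ * (dcoef α (n + 1 + 2) : ℂ)) =
          (C (α : ℂ) - ((n : MvPolynomial (Fin 2) ℂ) + 2)) * C ((2 * Complex.I)⁻¹ * g) := by
        rw [show ((n : MvPolynomial (Fin 2) ℂ) + 2) = C ((n : ℂ) + 2) by
          rw [C_add, map_natCast, map_ofNat], ← C_sub, ← C_mul]
        congr 1
        rw [hg, show n + 1 + 2 = (n + 2) + 1 by ring, dcoef, Finset.prod_range_succ, ← dcoef,
          show n + 1 + 3 = (n + 3) + 1 by ring, pow_succ, mul_inv]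
        push_cast
        ring
      have hDE : eulerDer α E = eulerDer α (E - C ((2 * Complex.I)⁻¹ * g)) := by
        rw [map_sub, ← algebraMap_eq, Derivation.map_algebraMap, sub_zero]
      rw [hg', hDE]
      set e := C ((2 * Complex.I)⁻¹ * g)
      have : C (α : ℂ) * X 0 ^ 2 * E - ((n : MvPolynomial (Fin 2) ℂ) + 2) * E + eulerDer α (E - e) -
            X 1 * (1 - X 0 ^ 2) * (C (2 * Complex.I)⁻¹ * potFactor α) * E * (r' + r - 2) -
            (C (α : ℂ) - ((n : MvPolynomial (Fin 2) ℂ) + 2)) * e =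
          (C (α : ℂ) * X 0 ^ 2 - ((n : MvPolynomial (Fin 2) ℂ) + 2)) * (E - e) +
          eulerDer α (E - e) -
          (1 - X 0 ^ 2) * (X 1 * (C (2 * Complex.I)⁻¹ * potFactor α) * E * (r' + r - 2) +
            C (α : ℂ) * e) := by ring
      rw [this]
      exact dvd_sub (dvd_add (hED.mul_left _) (dvd_eulerDer α hED)) (hsq.mul_right _)
    · rw [Finset.sum_range_succ]
      have hc : C (-((2 * Complex.I) ^ (n + 4))⁻¹ * (dcoef α (n + 2) : ℂ)) =
          (C ((2 * Complex.I)⁻¹ * g) : MvPolynomial (Fin 2) ℂ) := by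
        congr 1
        rw [hg, show n + 4 = (n + 3) + 1 by ring, pow_succ, mul_inv]
        ring
      rw [hc]
      set e := (C ((2 * Complex.I)⁻¹ * g) : MvPolynomial (Fin 2) ℂ)
      have := dvd_add hH (hED.mul_left (X 1 ^ n))
      convert this using 1
      rw [hH']; ring
    · have hDe : eulerDer α ((1 - X 0 ^ 2) * X 1 ^ (n + 2) * E) = (1 - X 0 ^ 2) * X 1 ^ (n + 2) *
          (C (α : ℂ) * X 0 ^ 2 * E - ((n : MvPolynomial (Fin 2) ℂ) + 2) * E + eulerDer α E) := by
        simp only [Derivation.leibniz, eulerDer_one_sub_sq, eulerDer_X1_pow, smul_eq_mul]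
        push_cast
        ring
      change riccati α r' = _
      rw [riccati, hrr, map_add, hDe, potPoly]
      rw [riccati, potPoly] at hr
      linear_combination hr - X 0 * (1 - X 0 ^ 2) * X 1 ^ (n + 2) * G * h2 -
        C (2 * Complex.I) * (1 - X 0 ^ 2) * X 1 ^ (n + 2) * hE

end RiccatiPolynomials

section Profile

variable {α θ : ℝ}

lemma spd_eq_of_pos {y : ℝ} (hy : 0 < y) : spd α θ y = (1 + θ * y ^ α) ^ (-(1 / 2) : ℝ) := by
  rw [spd, max_eq_left hy.le]

lemma one_le_profile (hθ : 0 < θ) (y : ℝ) : 1 ≤ 1 + θ * (max y 0) ^ α := by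
  have := Real.rpow_nonneg (le_max_right y 0) α
  nlinarith [mul_nonneg hθ.le this]

lemma spd_pos (hθ : 0 < θ) (y : ℝ) : 0 < spd α θ y :=
  Real.rpow_pos_of_pos (by linarith [one_le_profile (α := α) hθ y]) _

lemma spd_le_one (hθ : 0 < θ) (y : ℝ) : spd α θ y ≤ 1 :=
  Real.rpow_le_one_of_one_le_of_nonpos (one_le_profile hθ y) (by norm_num)

lemma spd_sq (hθ : 0 < θ) {y : ℝ} (hy : 0 < y) : spd α θ y ^ 2 = (1 + θ * y ^ α)⁻¹ := by
  have h := one_le_profile (α := α) hθ y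
  rw [max_eq_left hy.le] at h
  rw [spd_eq_of_pos hy, ← Real.rpow_natCast, ← Real.rpow_mul (by linarith), ← Real.rpow_neg_one]
  norm_num

lemma one_sub_spd_sq (hθ : 0 < θ) {y : ℝ} (hy : 0 < y) :
    1 - spd α θ y ^ 2 = θ * y ^ α * spd α θ y ^ 2 := by
  have h := one_le_profile (α := α) hθ y
  rw [max_eq_left hy.le] at h
  rw [spd_sq hθ hy]
  field_simp
  ring

lemma hasDerivAt_spd (hθ : 0 < θ) {y : ℝ} (hy : 0 < y) :
    HasDerivAt (spd α θ) (-(α / 2) * spd α θ y * (1 - spd α θ y ^ 2) * y⁻¹) y := by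
  have h := one_le_profile (α := α) hθ y
  rw [max_eq_left hy.le] at h
  have h1 : HasDerivAt (fun x : ℝ => (1 + θ * x ^ α) ^ (-(1 / 2) : ℝ))
      (θ * (α * y ^ (α - 1)) * (-(1 / 2) : ℝ) * (1 + θ * y ^ α) ^ (-(1 / 2) - 1 : ℝ)) y :=
    (((Real.hasDerivAt_rpow_const (Or.inl hy.ne')).const_mul θ).const_add 1).rpow_const
      (Or.inl (by linarith))
  have h2 : spd α θ =ᶠ[𝓝 y] fun x : ℝ => (1 + θ * x ^ α) ^ (-(1 / 2) : ℝ) := by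
    filter_upwards [lt_mem_nhds hy] with x hx using spd_eq_of_pos hx
  refine (h1.congr_of_eventuallyEq h2).congr_deriv ?_
  rw [one_sub_spd_sq hθ hy, spd_sq hθ hy, spd_eq_of_pos hy,
    Real.rpow_sub_one (x := 1 + θ * y ^ α) (by linarith), Real.rpow_sub_one hy.ne']
  field_simp

lemma hasDerivAt_sqrt_spd (hθ : 0 < θ) {y : ℝ} (hy : 0 < y) :
    HasDerivAt (fun y => spd α θ y ^ ((1 : ℝ) / 2))
      (-(α / 4) * spd α θ y ^ ((1 : ℝ) / 2) * (1 - spd α θ y ^ 2) * y⁻¹) y := by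
  have hp := spd_pos (α := α) hθ y
  refine ((hasDerivAt_spd hθ hy).rpow_const (p := 1 / 2) (Or.inl hp.ne')).congr_deriv ?_
  rw [Real.rpow_sub_one hp.ne']
  field_simp
  ring

lemma Mfun_eq (hθ : 0 < θ) {y : ℝ} (hy : 0 < y) :
    Mfun α θ y = (1 - spd α θ y ^ 2) * y⁻¹ ^ 2 * (spd α θ y * (α / 4 +
      α ^ 2 / 16 * (1 - spd α θ y ^ 2) - α ^ 2 / 4 * spd α θ y ^ 2)) := by
  have hp := spd_pos (α := α) hθ y
  have h1 : deriv (fun y => spd α θ y ^ ((1 : ℝ) / 2)) =ᶠ[𝓝 y]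
      fun y => -(α / 4) * spd α θ y ^ ((1 : ℝ) / 2) * (1 - spd α θ y ^ 2) * y⁻¹ := by
    filter_upwards [lt_mem_nhds hy] with x hx using (hasDerivAt_sqrt_spd hθ hx).deriv
  have h2 := ((((hasDerivAt_sqrt_spd (α := α) hθ hy).const_mul (-(α / 4))).mul
    (((hasDerivAt_spd (α := α) hθ hy).pow 2).const_sub 1)).mul (hasDerivAt_inv hy.ne')).deriv
  have hsq : spd α θ y ^ ((1 : ℝ) / 2) * spd α θ y ^ ((1 : ℝ) / 2) = spd α θ y := by
    rw [← Real.rpow_add hp]; norm_num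
  rw [Mfun, if_pos hy, h1.deriv_eq]
  refine (congrArg _ h2).trans ?_
  simp only [Pi.mul_apply, Pi.pow_apply]
  set w := spd α θ y
  set v := w ^ ((1 : ℝ) / 2)
  push_cast
  have hy2 : (y ^ 2)⁻¹ = y⁻¹ ^ 2 := by rw [inv_pow]
  rw [hy2]
  linear_combination ((1 - w ^ 2) * y⁻¹ ^ 2 * (α / 4 +
      α ^ 2 / 16 * (1 - w ^ 2) - α ^ 2 / 4 * w ^ 2)) * hsq

lemma continuous_inv_spd (hα : 0 ≤ α) (hθ : 0 < θ) : Continuous fun y => (spd α θ y)⁻¹ := by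
  refine Continuous.inv₀ ?_ fun y => (spd_pos hθ y).ne'
  refine Continuous.rpow_const ?_ fun y => Or.inl (by linarith [one_le_profile (α := α) hθ y])
  exact continuous_const.add (continuous_const.mul
    ((continuous_id.max continuous_const).rpow_const fun _ => Or.inr hα))

lemma hasDerivAt_phase (hα : 0 ≤ α) (hθ : 0 < θ) (y : ℝ) :
    HasDerivAt (phase α θ) (spd α θ y)⁻¹ y :=
  ((continuous_inv_spd hα hθ).integral_hasStrictDerivAt 0 y).hasDerivAt

lemma tendsto_spd (y : ℝ) :
    Tendsto (fun θ => spd α θ y) (𝓝[>] 0) (𝓝 1) := by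
  have : ContinuousAt (fun θ : ℝ => (1 + θ * (max y 0) ^ α) ^ (-(1 / 2) : ℝ)) 0 :=
    ContinuousAt.rpow_const (by fun_prop) (Or.inl (by simp))
  have h := this.tendsto
  simp only [zero_mul, add_zero, Real.one_rpow] at h
  exact h.mono_left nhdsWithin_le_nhds

lemma tendsto_phase (hα : 0 ≤ α) {x : ℝ} (hx : 0 < x) :
    Tendsto (fun θ => phase α θ x) (𝓝[>] 0) (𝓝 x) := by
  have h : Tendsto (fun θ => ∫ y in (0:ℝ)..x, (spd α θ y)⁻¹) (𝓝[>] 0)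
      (𝓝 (∫ _ in (0:ℝ)..x, (1:ℝ))) := by
    refine intervalIntegral.tendsto_integral_filter_of_dominated_convergence
      (fun _ => (spd α 1 x)⁻¹) ?_ ?_ ?_ ?_
    · filter_upwards [self_mem_nhdsWithin] with θ hθ
      exact (continuous_inv_spd hα hθ).aestronglyMeasurable
    · filter_upwards [Ioo_mem_nhdsGT (zero_lt_one (α := ℝ))] with θ hθ
      refine Eventually.of_forall fun y hy => ?_
      rw [uIoc_of_le hx.le] at hy
      rw [Real.norm_of_nonneg (inv_nonneg.2 (spd_pos hθ.1 y).le)]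
      refine inv_anti₀ (spd_pos one_pos x) ?_
      rw [spd_eq_of_pos hx, spd_eq_of_pos hy.1]
      have h1 : y ^ α ≤ x ^ α := Real.rpow_le_rpow hy.1.le hy.2 hα
      have h2 : 0 ≤ y ^ α := Real.rpow_nonneg hy.1.le α
      refine Real.rpow_le_rpow_of_nonpos (by nlinarith [hθ.1]) (by nlinarith [hθ.1, hθ.2])
        (by norm_num)
    · exact intervalIntegrable_const
    · refine Eventually.of_forall fun y hy => ?_
      rw [uIoc_of_le hx.le] at hy
      simpa using (tendsto_spd (α := α) y).inv₀ one_ne_zero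
  simpa [phase] using h

lemma one_sub_spd_sq_nonneg (hθ : 0 < θ) (y : ℝ) : 0 ≤ 1 - spd α θ y ^ 2 := by
  nlinarith [spd_pos (α := α) hθ y, spd_le_one (α := α) hθ y]

lemma one_sub_spd_sq_le (hθ : 0 < θ) {y : ℝ} (hy : 0 < y) : 1 - spd α θ y ^ 2 ≤ θ * y ^ α := by
  rw [one_sub_spd_sq hθ hy]
  have := mul_nonneg hθ.le (Real.rpow_nonneg hy.le α)
  nlinarith [one_sub_spd_sq_nonneg (α := α) hθ y]

end Profile

section Evaluation

open MvPolynomial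

/-- Evaluation of a polynomial at `W = c(y)`, `Z = 1/y`. -/
def profEval (α θ : ℝ) (f : MvPolynomial (Fin 2) ℂ) (y : ℝ) : ℂ :=
  eval ![(spd α θ y : ℂ), ((y⁻¹ : ℝ) : ℂ)] f

variable {α θ x₀ : ℝ}

lemma hasDerivAt_profEval (hθ : 0 < θ) (f : MvPolynomial (Fin 2) ℂ) {y : ℝ} (hy : 0 < y) :
    HasDerivAt (profEval α θ f) ((y⁻¹ : ℝ) * profEval α θ (eulerDer α f) y) y := by
  induction f using MvPolynomial.induction_on with
  | C a =>
    have : eulerDer α (C a) = 0 := by rw [← algebraMap_eq, Derivation.map_algebraMap]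
    have hc : profEval α θ (C a) = fun _ => a := funext fun x => by simp [profEval]
    simpa [this, hc, profEval] using hasDerivAt_const y a
  | add p q hp hq =>
    have h := hp.add hq
    refine (h.congr_of_eventuallyEq (.of_forall fun x => ?_)).congr_deriv ?_
    · simp [profEval]
    · simp only [profEval, map_add]; ring
  | mul_X p i hp =>
    have hX : HasDerivAt (profEval α θ (X i)) ((y⁻¹ : ℝ) * profEval α θ (eulerDer α (X i)) y) y := by
      fin_cases i
      · simp only [Fin.zero_eta, Fin.isValue]
        rw [eulerDer_X0]
        have h := (hasDerivAt_spd (α := α) hθ hy).ofReal_comp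
        refine (h.congr_of_eventuallyEq (.of_forall fun x => ?_)).congr_deriv ?_
        · simp [profEval]
        · simp only [profEval, map_mul, map_neg, map_sub, map_pow, map_one, eval_C, eval_X,
            Matrix.cons_val_zero]
          push_cast
          ring
      · simp only [Fin.mk_one, Fin.isValue]
        rw [eulerDer_X1]
        have h := (hasDerivAt_inv hy.ne').ofReal_comp
        refine (h.congr_of_eventuallyEq (.of_forall fun x => ?_)).congr_deriv ?_
        · simp [profEval]
        · simp only [profEval, map_neg, eval_X, Matrix.cons_val_one, Matrix.cons_val_zero]
          push_cast
          ring
    have h := hp.mul hX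
    refine (h.congr_of_eventuallyEq (.of_forall fun x => ?_)).congr_deriv ?_
    · simp [profEval]
    · simp only [profEval, Derivation.leibniz, map_add, map_mul, smul_eq_mul]; ring

lemma continuousOn_profEval (hθ : 0 < θ) (f : MvPolynomial (Fin 2) ℂ) :
    ContinuousOn (profEval α θ f) (Ioi 0) :=
  fun _ hy => (hasDerivAt_profEval hθ f hy).continuousAt.continuousWithinAt

lemma exists_profEval_bound (α : ℝ) (hx₀ : 0 < x₀) (f : MvPolynomial (Fin 2) ℂ) :
    ∃ C, 0 ≤ C ∧ ∀ θ, 0 < θ → ∀ y, x₀ ≤ y → ‖profEval α θ f y‖ ≤ C := by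
  have hK : IsCompact (Icc (0 : ℝ) 1 ×ˢ Icc (0 : ℝ) x₀⁻¹) := isCompact_Icc.prod isCompact_Icc
  have hc : Continuous fun p : ℝ × ℝ => eval ![(p.1 : ℂ), (p.2 : ℂ)] f := by
    refine (MvPolynomial.continuous_eval f).comp (continuous_pi fun i => ?_)
    fin_cases i <;> simp <;> fun_prop
  obtain ⟨C, hC⟩ := hK.exists_bound_of_continuousOn hc.continuousOn
  refine ⟨max C 0, le_max_right _ _, fun θ hθ y hy => le_max_of_le_left ?_⟩
  refine hC (spd α θ y, y⁻¹) ⟨⟨(spd_pos hθ y).le, spd_le_one hθ y⟩, ?_, ?_⟩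
  · exact inv_nonneg.2 (hx₀.le.trans hy)
  · exact inv_anti₀ hx₀ hy

lemma tendsto_profEval (f : MvPolynomial (Fin 2) ℂ) (y : ℝ) :
    Tendsto (fun θ => profEval α θ f y) (𝓝[>] 0) (𝓝 (eval ![1, ((y⁻¹ : ℝ) : ℂ)] f)) := by
  have h : Tendsto (fun θ => ![(spd α θ y : ℂ), ((y⁻¹ : ℝ) : ℂ)]) (𝓝[>] 0)
      (𝓝 ![1, ((y⁻¹ : ℝ) : ℂ)]) := by
    refine tendsto_pi_nhds.2 fun i => ?_
    fin_cases i
    · simpa [Function.comp_def] using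
        (Complex.continuous_ofReal.tendsto 1).comp (tendsto_spd (α := α) y)
    · simp
  exact ((MvPolynomial.continuous_eval f).tendsto _).comp h

lemma ofReal_Mfun (hθ : 0 < θ) {y : ℝ} (hy : 0 < y) :
    (Mfun α θ y : ℂ) = profEval α θ (potPoly α) y := by
  rw [Mfun_eq hθ hy]
  simp only [profEval, potPoly, potFactor, map_mul, map_sub, map_add, map_pow, map_one, eval_C,
    eval_X, Matrix.cons_val_zero, Matrix.cons_val_one]
  push_cast
  rfl

/-- A polynomial divisible by `1 - W²`, divided by `θ`, converges as `θ → 0`. -/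
lemma tendsto_profEval_div (f : MvPolynomial (Fin 2) ℂ) {y : ℝ} (hy : 0 < y) :
    Tendsto (fun θ => profEval α θ ((1 - X 0 ^ 2) * f) y / (θ : ℂ)) (𝓝[>] 0)
      (𝓝 (((y ^ α : ℝ) : ℂ) * eval ![1, ((y⁻¹ : ℝ) : ℂ)] f)) := by
  have h1 := tendsto_profEval (α := α) (C ((y ^ α : ℝ) : ℂ) * (X 0 ^ 2 * f)) y
  simp only [map_mul, map_pow, eval_C, eval_X, Matrix.cons_val_zero, one_pow, one_mul] at h1
  refine h1.congr' ?_
  filter_upwards [self_mem_nhdsWithin] with θ hθ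
  have hθ' : (θ : ℂ) ≠ 0 := by exact_mod_cast (show (0:ℝ) < θ from hθ).ne'
  have h := congrArg (fun t : ℝ => (t : ℂ)) (one_sub_spd_sq (α := α) hθ hy)
  push_cast at h
  simp only [profEval, map_mul, map_pow, map_sub, map_one, eval_C, eval_X, Matrix.cons_val_zero]
  rw [h]
  push_cast
  field_simp

lemma norm_profEval_one_sub_sq_mul (hθ : 0 < θ) (f : MvPolynomial (Fin 2) ℂ) {y : ℝ} :
    ‖profEval α θ ((1 - X 0 ^ 2) * f) y‖ = (1 - spd α θ y ^ 2) * ‖profEval α θ f y‖ := by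
  have : profEval α θ ((1 - X 0 ^ 2) * f) y =
      ((1 - spd α θ y ^ 2 : ℝ) : ℂ) * profEval α θ f y := by
    simp [profEval]
  rw [this, norm_mul, Complex.norm_real, Real.norm_of_nonneg (one_sub_spd_sq_nonneg hθ y)]

lemma norm_profEval_X1_pow_mul (k : ℕ) (f : MvPolynomial (Fin 2) ℂ) {y : ℝ} (hy : 0 < y) :
    ‖profEval α θ (X 1 ^ k * f) y‖ = y⁻¹ ^ k * ‖profEval α θ f y‖ := by
  have : profEval α θ (X 1 ^ k * f) y = ((y⁻¹ ^ k : ℝ) : ℂ) * profEval α θ f y := by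
    simp [profEval]
  rw [this, norm_mul, Complex.norm_real, Real.norm_of_nonneg (by positivity)]

lemma integrableOn_inv_sq (hx₀ : 0 < x₀) : IntegrableOn (fun y : ℝ => y⁻¹ ^ 2) (Ioi x₀) := by
  refine (integrableOn_Ioi_rpow_of_lt (a := -2) (by norm_num) hx₀).congr_fun (fun y hy => ?_)
    measurableSet_Ioi
  have : 0 < y := hx₀.trans hy
  simp only
  rw [Real.rpow_neg this.le, inv_pow]
  norm_cast

lemma integrableOn_profEval (hx₀ : 0 < x₀) (hθ : 0 < θ) (f : MvPolynomial (Fin 2) ℂ) :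
    IntegrableOn (profEval α θ (X 1 ^ 2 * f)) (Ioi x₀) := by
  obtain ⟨C, hC0, hC⟩ := exists_profEval_bound α hx₀ f
  refine ((integrableOn_inv_sq hx₀).mul_const C).mono' ?_ ?_
  · exact ((continuousOn_profEval hθ _).mono (Ioi_subset_Ioi hx₀.le)).aestronglyMeasurable
      measurableSet_Ioi
  · refine (ae_restrict_iff' measurableSet_Ioi).2 (.of_forall fun y hy => ?_)
    rw [norm_profEval_X1_pow_mul 2 f (hx₀.trans hy)]
    have := hx₀.trans hy
    gcongr
    exact hC θ hθ y (le_of_lt hy)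

lemma integrableOn_Mfun (hx₀ : 0 < x₀) (hθ : 0 < θ) :
    IntegrableOn (fun y => (Mfun α θ y : ℂ)) (Ioi x₀) := by
  refine (integrableOn_profEval (α := α) hx₀ hθ ((1 - X 0 ^ 2) * potFactor α)).congr_fun
    (fun y hy => ?_) measurableSet_Ioi
  rw [ofReal_Mfun hθ (hx₀.trans hy), potPoly]
  congr 1; ring

lemma tendsto_profEval_atTop (hθ : 0 < θ) (f : MvPolynomial (Fin 2) ℂ) :
    Tendsto (profEval α θ (X 1 ^ 2 * f)) atTop (𝓝 0) := by
  obtain ⟨C, hC0, hC⟩ := exists_profEval_bound α one_pos f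
  have h : Tendsto (fun y : ℝ => y⁻¹ ^ 2 * C) atTop (𝓝 0) := by
    simpa using (tendsto_inv_atTop_zero.pow 2).mul_const C
  refine squeeze_zero_norm' ?_ h
  filter_upwards [eventually_ge_atTop 1] with y hy
  rw [norm_profEval_X1_pow_mul 2 f (by linarith)]
  gcongr
  exact hC θ hθ y hy

lemma tendsto_Mtail (hx₀ : 0 < x₀) : Tendsto (fun θ => Mtail α θ x₀) (𝓝[>] 0) (𝓝 0) := by
  obtain ⟨C, hC0, hC⟩ := exists_profEval_bound α hx₀ ((1 - X 0 ^ 2) * potFactor α)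
  have hM : ∀ θ, 0 < θ → ∀ y, 0 < y → |Mfun α θ y| =
      ‖profEval α θ (X 1 ^ 2 * ((1 - X 0 ^ 2) * potFactor α)) y‖ := by
    intro θ hθ y hy
    rw [← Real.norm_eq_abs, ← Complex.norm_real, ofReal_Mfun hθ hy, potPoly]
    congr 2; ring
  have h : Tendsto (fun θ => ∫ y in Ioi x₀, |Mfun α θ y|) (𝓝[>] 0)
      (𝓝 (∫ _ in Ioi x₀, (0:ℝ))) := by
    refine tendsto_integral_filter_of_dominated_convergence (fun y => y⁻¹ ^ 2 * C) ?_ ?_ ?_ ?_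
    · filter_upwards [self_mem_nhdsWithin] with θ hθ
      have := (integrableOn_Mfun (α := α) hx₀ hθ).norm.aestronglyMeasurable
      simpa only [Complex.norm_real, Real.norm_eq_abs] using this
    · filter_upwards [self_mem_nhdsWithin] with θ hθ
      refine (ae_restrict_iff' measurableSet_Ioi).2 (.of_forall fun y hy => ?_)
      have hy0 := hx₀.trans hy
      rw [Real.norm_eq_abs, abs_abs, hM θ hθ y hy0, norm_profEval_X1_pow_mul 2 _ hy0]
      gcongr
      exact hC θ hθ y (le_of_lt hy)
    · exact (integrableOn_inv_sq hx₀).mul_const C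
    · refine (ae_restrict_iff' measurableSet_Ioi).2 (.of_forall fun y hy => ?_)
      have h := (tendsto_profEval (α := α) (X 1 ^ 2 * ((1 - X 0 ^ 2) * potFactor α)) y).norm
      simp only [map_mul, map_sub, map_one, map_pow, eval_X, Matrix.cons_val_zero, one_pow,
        sub_self, zero_mul, mul_zero, norm_zero] at h
      refine h.congr' ?_
      filter_upwards [self_mem_nhdsWithin] with θ hθ
      rw [hM θ hθ y (hx₀.trans hy)]
  simpa [Mtail] using h

end Evaluation

section Volterra

variable {α θ x₀ : ℝ}

section Primitive

variable {f : ℝ → ℂ}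

lemma intervalIntegrable_of_integrableOn_Ioi (hi : IntegrableOn f (Ioi x₀)) {x : ℝ}
    (hx : x₀ ≤ x) : IntervalIntegrable f volume x₀ x :=
  (intervalIntegrable_iff_integrableOn_Ioc_of_le hx).2 (hi.mono_set Ioc_subset_Ioi_self)

lemma hasDerivAt_primitive (hf : ContinuousOn f (Ici x₀)) (hi : IntegrableOn f (Ioi x₀)) {x : ℝ}
    (hx : x₀ < x) : HasDerivAt (fun x => ∫ y in x₀..x, f y) (f x) x :=
  intervalIntegral.integral_hasDerivAt_right (intervalIntegrable_of_integrableOn_Ioi hi hx.le)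
    ((hf.mono Ioi_subset_Ici_self).stronglyMeasurableAtFilter isOpen_Ioi x hx)
    (hf.continuousAt (Ici_mem_nhds hx))

lemma continuousOn_primitive_Ici (hi : IntegrableOn f (Ioi x₀)) :
    ContinuousOn (fun x => ∫ y in x₀..x, f y) (Ici x₀) := by
  intro x hx
  have hx' : x₀ ≤ x + 1 := (mem_Ici.1 hx).trans (by linarith)
  have h := intervalIntegral.continuousOn_primitive_interval'
    (intervalIntegrable_of_integrableOn_Ioi hi hx') (left_mem_uIcc)
  rw [uIcc_of_le hx'] at h
  refine (h x ⟨hx, by linarith⟩).mono_of_mem_nhdsWithin ?_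
  have : Ici x₀ ∩ Iio (x + 1) ∈ 𝓝[Ici x₀] x :=
    inter_mem self_mem_nhdsWithin (mem_nhdsWithin_of_mem_nhds (Iio_mem_nhds (by linarith)))
  exact mem_of_superset this fun y hy => ⟨hy.1, le_of_lt hy.2⟩

lemma norm_primitive_le {g : ℝ → ℝ} (hg : IntegrableOn g (Ioi x₀))
    (hfg : ∀ y ∈ Ioi x₀, ‖f y‖ ≤ g y) {x : ℝ} (hx : x₀ ≤ x) :
    ‖∫ y in x₀..x, f y‖ ≤ ∫ y in Ioi x₀, g y := by
  rw [intervalIntegral.integral_of_le hx]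
  refine (norm_integral_le_of_norm_le (hg.mono_set Ioc_subset_Ioi_self)
    ((ae_restrict_iff' measurableSet_Ioc).2 (.of_forall fun y hy => hfg y hy.1))).trans ?_
  refine setIntegral_mono_set hg ?_ Ioc_subset_Ioi_self.eventuallyLE
  exact (ae_restrict_iff' measurableSet_Ioi).2
    (.of_forall fun y hy => (norm_nonneg _).trans (hfg y hy))

end Primitive

lemma norm_exp_two_I_mul (t : ℝ) : ‖Complex.exp (2 * Complex.I * (t : ℂ))‖ = 1 := by
  rw [show 2 * Complex.I * (t : ℂ) = ((2 * t : ℝ) : ℂ) * Complex.I by push_cast; ring]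
  exact Complex.norm_exp_ofReal_mul_I _

lemma norm_exp_neg_two_I_mul (t : ℝ) : ‖Complex.exp (-2 * Complex.I * (t : ℂ))‖ = 1 := by
  rw [show -2 * Complex.I * (t : ℂ) = ((-2 * t : ℝ) : ℂ) * Complex.I by push_cast; ring]
  exact Complex.norm_exp_ofReal_mul_I _

lemma integrableOn_abs_Mfun (hx₀ : 0 < x₀) (hθ : 0 < θ) :
    IntegrableOn (fun y => |Mfun α θ y|) (Ioi x₀) := by
  have h := (integrableOn_Mfun (α := α) hx₀ hθ).norm
  simpa only [IntegrableOn, Complex.norm_real, Real.norm_eq_abs] using h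

lemma continuousOn_Mfun (hθ : 0 < θ) : ContinuousOn (fun y => (Mfun α θ y : ℂ)) (Ioi 0) :=
  (continuousOn_profEval hθ (potPoly α)).congr fun _ hy => ofReal_Mfun hθ hy

lemma continuous_phase (hα : 0 ≤ α) (hθ : 0 < θ) : Continuous (phase α θ) :=
  continuous_iff_continuousAt.2 fun y => (hasDerivAt_phase hα hθ y).continuousAt

lemma norm_Kop_zero_le (hx₀ : 0 < x₀) (hθ : 0 < θ) {S : ℝ → ℂ} {T : ℝ}
    (hT : ∀ x ∈ Ici x₀, ‖S x‖ ≤ T) {x : ℝ} (hx : x₀ ≤ x) :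
    ‖Kop α θ x₀ 0 S x‖ ≤ T * Mtail α θ x₀ / 2 := by
  have hi : IntegrableOn (fun y => |Mfun α θ y| * T) (Ioi x₀) :=
    (integrableOn_abs_Mfun hx₀ hθ).mul_const T
  have h1 : ‖∫ y in x₀..x, (Mfun α θ y : ℂ) * S y *
        Complex.exp (-2 * Complex.I * (1 + Complex.I * ((0 : ℝ) : ℂ)) *
          ((phase α θ x - phase α θ y : ℝ) : ℂ))‖ ≤ ∫ y in Ioc x₀ x, |Mfun α θ y| * T := by
    rw [intervalIntegral.integral_of_le hx]
    refine norm_integral_le_of_norm_le (hi.mono_set Ioc_subset_Ioi_self)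
      ((ae_restrict_iff' measurableSet_Ioc).2 (.of_forall fun y hy => ?_))
    rw [Complex.ofReal_zero, mul_zero, add_zero, mul_one, norm_mul, norm_exp_neg_two_I_mul,
      mul_one, norm_mul, Complex.norm_real, Real.norm_eq_abs]
    exact mul_le_mul_of_nonneg_left (hT y hy.1.le) (abs_nonneg _)
  have h2 : ‖∫ y in Ioi x, (Mfun α θ y : ℂ) * S y‖ ≤ ∫ y in Ioi x, |Mfun α θ y| * T := by
    refine norm_integral_le_of_norm_le (hi.mono_set (Ioi_subset_Ioi hx))
      ((ae_restrict_iff' measurableSet_Ioi).2 (.of_forall fun y hy => ?_))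
    rw [norm_mul, Complex.norm_real, Real.norm_eq_abs]
    exact mul_le_mul_of_nonneg_left (hT y (hx.trans (le_of_lt hy))) (abs_nonneg _)
  have h3 : (∫ y in Ioc x₀ x, |Mfun α θ y| * T) + ∫ y in Ioi x, |Mfun α θ y| * T =
      T * Mtail α θ x₀ := by
    rw [← setIntegral_union Ioc_disjoint_Ioi_same measurableSet_Ioi
      (hi.mono_set Ioc_subset_Ioi_self) (hi.mono_set (Ioi_subset_Ioi hx)),
      Ioc_union_Ioi_eq_Ioi hx, integral_mul_const, Mtail, mul_comm]
  have h4 : ‖(2 * Complex.I * (1 + Complex.I * ((0 : ℝ) : ℂ)))⁻¹‖ = 1 / 2 := by simp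
  rw [Kop, norm_mul, h4]
  have := norm_add_le_of_le h1 h2
  linarith

lemma IsVolterraSol.norm_le_two (hx₀ : 0 < x₀) (hθ : 0 < θ) {S : ℝ → ℂ}
    (hS : IsVolterraSol α θ x₀ S) (hI : Mtail α θ x₀ ≤ 1) {x : ℝ} (hx : x ∈ Ici x₀) :
    ‖S x‖ ≤ 2 := by
  obtain ⟨⟨C, hC⟩, -, hV⟩ := hS
  set T := sSup ((fun x => ‖S x‖) '' Ici x₀) with hTdef
  have hT : ∀ x ∈ Ici x₀, ‖S x‖ ≤ T := fun x hx =>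
    le_csSup ⟨C, by rintro _ ⟨y, hy, rfl⟩; exact hC y hy⟩ ⟨x, hx, rfl⟩
  have hT0 : 0 ≤ T := (norm_nonneg _).trans (hT x hx)
  have hle : T ≤ 1 + T / 2 := by
    refine csSup_le ⟨_, x, hx, rfl⟩ ?_
    rintro _ ⟨y, hy, rfl⟩
    simp only
    rw [hV y hy]
    refine (norm_add_le_of_le (norm_exp_neg_two_I_mul _).le (norm_Kop_zero_le hx₀ hθ hT hy)).trans ?_
    nlinarith
  linarith [hT x hx]

open MvPolynomial in
/-- Pairing the Volterra solution with an approximate solution of the Riccati equation expresses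
the reflection coefficient through a boundary term and the Riccati residual. -/
theorem IsVolterraSol.exists_reflection_formula (hα : 0 ≤ α) (hx₀ : 0 < x₀) (hθ : 0 < θ)
    {S : ℝ → ℂ} (hS : IsVolterraSol α θ x₀ S) (hI : Mtail α θ x₀ ≤ 1)
    {r R : MvPolynomial (Fin 2) ℂ} (h : riccati α (X 1 ^ 2 * r) = X 0 * (X 1 ^ 2 * R))
    {C : ℝ} (hC : ∀ y, x₀ ≤ y → ‖profEval α θ (X 1 ^ 2 * r - 1) y‖ ≤ C)
    (hCI : C * Mtail α θ x₀ ≤ 1) :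
    ∃ Ψ : ℝ → ℂ, ContinuousOn Ψ (Ici x₀) ∧
      (∀ y ∈ Ici x₀, ‖Ψ y - Complex.exp (-2 * Complex.I * (phase α θ y : ℂ))‖ ≤
        (2 * C + 1) * Mtail α θ x₀) ∧
      Rx α θ x₀ S = -(∫ y in Ioi x₀, Ψ y * profEval α θ (X 1 ^ 2 * R) y) -
        profEval α θ (X 1 ^ 2 * r) x₀ * Complex.exp (-2 * Complex.I * (phase α θ x₀ : ℂ)) := by
  have hS2 : ∀ y ∈ Ici x₀, ‖S y‖ ≤ 2 := fun y hy => hS.norm_le_two hx₀ hθ hI hy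
  obtain ⟨-, hSc, hV⟩ := hS
  set I₀ := Mtail α θ x₀ with hI₀
  have hI0 : 0 ≤ I₀ := integral_nonneg fun _ => abs_nonneg _
  have hC0 : 0 ≤ C := (norm_nonneg _).trans (hC x₀ le_rfl)
  have hIci : Ici x₀ ⊆ Ioi (0:ℝ) := fun y hy => hx₀.trans_le hy
  have hMc := (continuousOn_Mfun (α := α) hθ).mono hIci
  have hMi := integrableOn_abs_Mfun (α := α) hx₀ hθ
  have hφ := continuous_phase hα hθ
  have integ : ∀ (f : ℝ → ℂ) (K : ℝ), ContinuousOn f (Ici x₀) →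
      (∀ y ∈ Ioi x₀, ‖f y‖ ≤ |Mfun α θ y| * K) → IntegrableOn f (Ioi x₀) := by
    intro f K hf hb
    exact (hMi.mul_const K).mono' ((hf.mono Ioi_subset_Ici_self).aestronglyMeasurable
      measurableSet_Ioi) ((ae_restrict_iff' measurableSet_Ioi).2 (.of_forall hb))
  have bound : ∀ (f : ℝ → ℂ) (K : ℝ), (∀ y ∈ Ioi x₀, ‖f y‖ ≤ |Mfun α θ y| * K) →
      ∀ x, x₀ ≤ x → ‖∫ y in x₀..x, f y‖ ≤ I₀ * K := by
    intro f K hb x hx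
    refine (norm_primitive_le (hMi.mul_const K) hb hx).trans_eq ?_
    rw [integral_mul_const]; rfl
  set fP : ℝ → ℂ := fun y => (Mfun α θ y : ℂ) * S y *
    Complex.exp (2 * Complex.I * (phase α θ y : ℂ)) with hfP
  set fB : ℝ → ℂ := fun y => (Mfun α θ y : ℂ) * S y with hfB
  set fQ : ℝ → ℂ := fun y => (Mfun α θ y : ℂ) * profEval α θ (X 1 ^ 2 * r - 1) y with hfQ
  have cP : ContinuousOn fP (Ici x₀) := (hMc.mul hSc).mul (by fun_prop)
  have cB : ContinuousOn fB (Ici x₀) := hMc.mul hSc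
  have cQ : ContinuousOn fQ (Ici x₀) := hMc.mul ((continuousOn_profEval hθ _).mono hIci)
  have bP : ∀ y ∈ Ioi x₀, ‖fP y‖ ≤ |Mfun α θ y| * 2 := fun y hy => by
    rw [hfP, norm_mul, norm_exp_two_I_mul, mul_one, norm_mul, Complex.norm_real, Real.norm_eq_abs]
    exact mul_le_mul_of_nonneg_left (hS2 y (Ioi_subset_Ici_self hy)) (abs_nonneg _)
  have bB : ∀ y ∈ Ioi x₀, ‖fB y‖ ≤ |Mfun α θ y| * 2 := fun y hy => by
    rw [hfB, norm_mul, Complex.norm_real, Real.norm_eq_abs]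
    exact mul_le_mul_of_nonneg_left (hS2 y (Ioi_subset_Ici_self hy)) (abs_nonneg _)
  have bQ : ∀ y ∈ Ioi x₀, ‖fQ y‖ ≤ |Mfun α θ y| * C := fun y hy => by
    rw [hfQ, norm_mul, Complex.norm_real, Real.norm_eq_abs]
    exact mul_le_mul_of_nonneg_left (hC y (le_of_lt hy)) (abs_nonneg _)
  have iP := integ fP 2 cP bP
  have iB := integ fB 2 cB bB
  have iQ := integ fQ C cQ bQ
  set c : ℂ := (2 * Complex.I)⁻¹ with hc
  have hcn : ‖c‖ = 1 / 2 := by simp [hc]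
  set P : ℝ → ℂ := fun x => ∫ y in x₀..x, fP y with hP
  set Q : ℝ → ℂ := fun x => ∫ y in x₀..x, fQ y with hQ
  set q : ℝ → ℂ := fun x => Complex.exp (-(c * Q x)) with hq
  set E : ℝ → ℂ := fun x => Complex.exp (-2 * Complex.I * (phase α θ x : ℂ)) with hE
  set A : ℝ → ℂ := fun x => E x * (1 + c * P x) with hA
  set B : ℝ → ℂ := fun x => c * ((∫ y in Ioi x₀, fB y) - ∫ y in x₀..x, fB y) with hB
  have hSAB : ∀ x ∈ Ici x₀, S x = A x + B x := by
    intro x hx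
    have h1 : (∫ y in Ioi x, fB y) = (∫ y in Ioi x₀, fB y) - ∫ y in x₀..x, fB y := by
      rw [eq_sub_iff_add_eq', intervalIntegral.integral_interval_add_Ioi iB
        (iB.mono_set (Ioi_subset_Ioi hx))]
    have h2 : (∫ y in x₀..x, (Mfun α θ y : ℂ) * S y *
        Complex.exp (-2 * Complex.I * (1 + Complex.I * ((0 : ℝ) : ℂ)) *
          ((phase α θ x - phase α θ y : ℝ) : ℂ))) = E x * P x := by
      rw [hP, ← intervalIntegral.integral_const_mul]
      refine intervalIntegral.integral_congr fun y _ => ?_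
      simp only [hfP, hE]
      rw [mul_left_comm, ← Complex.exp_add]
      congr 2
      push_cast
      ring
    rw [hV x hx, Kop, h2]
    change _ + _ * (_ + ∫ y in Ioi x, fB y) = _
    rw [h1, Complex.ofReal_zero, mul_zero, add_zero, mul_one]
    simp only [hA, hB, hE, hc]
    ring
  have hPn : ∀ x ∈ Ici x₀, ‖c * P x‖ ≤ I₀ := fun x hx => by
    rw [norm_mul, hcn]
    linarith [bound fP 2 bP x hx]
  have hqn : ∀ x ∈ Ici x₀, ‖q x - 1‖ ≤ C * I₀ := fun x hx => by
    have h1 : ‖-(c * Q x)‖ ≤ C * I₀ / 2 := by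
      rw [norm_neg, norm_mul, hcn]
      linarith [bound fQ C bQ x hx]
    linarith [Complex.norm_exp_sub_one_le (x := -(c * Q x)) (by linarith)]
  have hEn : ∀ x, ‖E x‖ = 1 := fun x => norm_exp_neg_two_I_mul _
  have cE : Continuous E := by fun_prop
  have cq : ContinuousOn q (Ici x₀) :=
    Complex.continuous_exp.comp_continuousOn
      (continuousOn_const.mul (continuousOn_primitive_Ici iQ)).neg
  have cA : ContinuousOn A (Ici x₀) := cE.continuousOn.mul
    (continuousOn_const.add (continuousOn_const.mul (continuousOn_primitive_Ici iP)))
  have cBB : ContinuousOn B (Ici x₀) :=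
    continuousOn_const.mul (continuousOn_const.sub (continuousOn_primitive_Ici iB))
  have hΨ : ∀ y ∈ Ici x₀, ‖q y * A y - E y‖ ≤ (2 * C + 1) * I₀ := by
    intro y hy
    have : q y * A y - E y = E y * ((q y - 1) * (1 + c * P y) + c * P y) := by
      simp only [hA]; ring
    rw [this, norm_mul, hEn, one_mul]
    have h1 : ‖1 + c * P y‖ ≤ 2 := by
      refine (norm_add_le_of_le norm_one.le (hPn y hy)).trans (by linarith)
    have h2 : ‖(q y - 1) * (1 + c * P y)‖ ≤ C * I₀ * 2 := by
      rw [norm_mul]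
      exact mul_le_mul (hqn y hy) h1 (norm_nonneg _) (by positivity)
    refine (norm_add_le_of_le h2 (hPn y hy)).trans (by linarith)
  have cΨ : ContinuousOn (fun y => q y * A y) (Ici x₀) := cq.mul cA
  have hΨn : ∀ y ∈ Ici x₀, ‖q y * A y‖ ≤ 2 * C + 2 := by
    intro y hy
    have : q y * A y = (q y * A y - E y) + E y := by ring
    rw [this]
    refine (norm_add_le_of_le (hΨ y hy) (hEn y).le).trans ?_
    nlinarith
  have hqn2 : ∀ y ∈ Ici x₀, ‖q y‖ ≤ 2 := by
    intro y hy
    have : q y = (q y - 1) + 1 := by ring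
    rw [this]
    refine (norm_add_le_of_le (hqn y hy) norm_one.le).trans (by linarith)
  set F : ℝ → ℂ := fun x => q x * A x * profEval α θ (X 1 ^ 2 * r) x + q x * B x with hF
  have hres : ∀ x, 0 < x → (x⁻¹ : ℝ) * profEval α θ (eulerDer α (X 1 ^ 2 * r)) x -
      2 * Complex.I * ((spd α θ x)⁻¹ : ℝ) * profEval α θ (X 1 ^ 2 * r) x -
      c * Mfun α θ x * (profEval α θ (X 1 ^ 2 * r) x - 1) ^ 2 =
      profEval α θ (X 1 ^ 2 * R) x := by
    intro x hx
    have hw : (spd α θ x : ℂ) ≠ 0 := by exact_mod_cast (spd_pos hθ x).ne'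
    have h' := congrArg (fun f => profEval α θ f x) h
    simp only [riccati] at h'
    rw [ofReal_Mfun hθ hx]
    refine mul_left_cancel₀ hw ?_
    simp only [profEval, map_mul, map_sub, map_pow, map_one, eval_C, eval_X,
      Matrix.cons_val_zero, Matrix.cons_val_one] at h' ⊢
    rw [← h']
    push_cast
    linear_combination (-2 * Complex.I * (((x : ℂ)⁻¹) ^ 2 *
      eval ![(spd α θ x : ℂ), ((x : ℂ)⁻¹)] r)) * mul_inv_cancel₀ hw
  have dF : ∀ x ∈ Ioi x₀, HasDerivAt F (q x * A x * profEval α θ (X 1 ^ 2 * R) x) x := by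
    intro x hx
    have hx0 : 0 < x := hx₀.trans hx
    have dE : HasDerivAt E (E x * (-2 * Complex.I * ((spd α θ x)⁻¹ : ℝ))) x :=
      ((hasDerivAt_phase hα hθ x).ofReal_comp.const_mul _).cexp
    have dq : HasDerivAt q (q x * (-(c * fQ x))) x :=
      ((hasDerivAt_primitive cQ iQ hx).const_mul c).neg.cexp
    have dA := dE.mul (((hasDerivAt_primitive cP iP hx).const_mul c).const_add 1)
    have dB : HasDerivAt B (c * (-fB x)) x :=
      ((hasDerivAt_primitive cB iB hx).const_sub _).const_mul c
    have dr := hasDerivAt_profEval (α := α) hθ (X 1 ^ 2 * r) hx0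
    refine (((dq.mul dA).mul dr).add (dq.mul dB)).congr_deriv ?_
    have hEP : E x * fP x = Mfun α θ x * S x := by
      simp only [hE, hfP]
      rw [mul_left_comm, ← Complex.exp_add]
      simp
    have hsub : profEval α θ (X 1 ^ 2 * r - 1) x = profEval α θ (X 1 ^ 2 * r) x - 1 := by
      simp [profEval]
    have hAx : A x = E x * (1 + c * P x) := rfl
    have hSx := hSAB x (Ioi_subset_Ici_self hx)
    rw [← hres x hx0]
    simp only [Pi.mul_apply]
    simp only [hfQ, hsub]
    change (q x * -(c * (↑(Mfun α θ x) * (profEval α θ (X 1 ^ 2 * r) x - 1))) * A x +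
      q x * (E x * (-2 * Complex.I * ((spd α θ x)⁻¹ : ℝ)) * (1 + c * P x) + E x * (c * fP x))) *
        profEval α θ (X 1 ^ 2 * r) x + q x * A x * _ +
        (q x * -(c * (↑(Mfun α θ x) * (profEval α θ (X 1 ^ 2 * r) x - 1))) * B x +
          q x * (c * -(Mfun α θ x * S x))) = _
    rw [hSx] at hEP ⊢
    linear_combination (q x * c * profEval α θ (X 1 ^ 2 * r) x) * hEP +
      (2 * Complex.I * q x * ((spd α θ x)⁻¹ : ℝ) * profEval α θ (X 1 ^ 2 * r) x) * hAx
  have hF0 : ContinuousWithinAt F (Ici x₀) x₀ :=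
    ((cΨ.mul ((continuousOn_profEval hθ _).mono hIci)).add (cq.mul cBB)) x₀ self_mem_Ici
  have iF : IntegrableOn (fun x => q x * A x * profEval α θ (X 1 ^ 2 * R) x) (Ioi x₀) := by
    refine Integrable.bdd_mul (integrableOn_profEval hx₀ hθ R)
      ((cΨ.mono Ioi_subset_Ici_self).aestronglyMeasurable measurableSet_Ioi)
      (c := 2 * C + 2) ?_
    exact (ae_restrict_iff' measurableSet_Ioi).2
      (.of_forall fun y hy => hΨn y (Ioi_subset_Ici_self hy))
  have tB : Tendsto B atTop (𝓝 0) := by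
    have h1 := intervalIntegral_tendsto_integral_Ioi x₀ iB tendsto_id
    simpa [hB] using (h1.const_sub (∫ y in Ioi x₀, fB y)).const_mul c
  have tF : Tendsto F atTop (𝓝 0) := by
    have h1 : Tendsto (fun x => (2 * C + 2) * ‖profEval α θ (X 1 ^ 2 * r) x‖ + 2 * ‖B x‖) atTop
        (𝓝 0) := by
      simpa using ((tendsto_profEval_atTop hθ r).norm.const_mul (2 * C + 2)).add
        (tB.norm.const_mul 2)
    refine squeeze_zero_norm' ?_ h1
    filter_upwards [eventually_ge_atTop x₀] with x hx
    refine norm_add_le_of_le ?_ ?_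
    · rw [norm_mul]
      exact mul_le_mul_of_nonneg_right (hΨn x hx) (norm_nonneg _)
    · rw [norm_mul]
      exact mul_le_mul_of_nonneg_right (hqn2 x hx) (norm_nonneg _)
  refine ⟨fun y => q y * A y, cΨ, hΨ, ?_⟩
  have key := integral_Ioi_of_hasDerivAt_of_tendsto hF0 dF iF tF
  have hF_x₀ : F x₀ = E x₀ * profEval α θ (X 1 ^ 2 * r) x₀ + Rx α θ x₀ S := by
    simp [hF, hq, hQ, hA, hP, hB, Rx, hc, hfB]
  rw [key, hF_x₀]
  ring

end Volterra

section Limit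

open MvPolynomial

lemma eval_one_eq_of_dvd_sub {f g : MvPolynomial (Fin 2) ℂ} (h : (1 - X 0) ∣ f - g) (z : ℂ) :
    eval ![1, z] f = eval ![1, z] g := by
  obtain ⟨k, hk⟩ := h
  have := congrArg (eval ![1, z]) hk
  simpa [sub_eq_zero] using this

lemma two_I_zpow (k : ℕ) (p : ℤ) (h : p = -(k : ℤ)) :
    (2 * Complex.I) ^ p = ((2 * Complex.I) ^ k)⁻¹ := by
  rw [h, zpow_neg, zpow_natCast]

lemma rpow_sub_natCast_eq {y : ℝ} (hy : 0 < y) (α : ℝ) (k : ℕ) :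
    y ^ (α - (k : ℝ)) = y ^ α * y⁻¹ ^ k := by
  rw [Real.rpow_sub hy, Real.rpow_natCast, inv_pow, div_eq_mul_inv]

end Limit

/-- limit of `R_{x₀}/θ` as `θ → 0⁺` for `α ≥ 1`. -/
theorem stmt8 (α x₀ : ℝ) (hα : 1 ≤ α) (hx₀ : 0 < x₀)
    (Rf : ℝ → ℂ)
    (hRf : ∀ᶠ θ in 𝓝[>] (0:ℝ), ∃ S : ℝ → ℂ, IsVolterraSol α θ x₀ S ∧ Rf θ = Rx α θ x₀ S) :
    Tendsto (fun θ : ℝ => Rf θ / (θ : ℂ)) (𝓝[>] (0:ℝ))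
      (𝓝 ((2 * Complex.I)⁻¹ *
        (Complex.exp (-2 * Complex.I * (x₀ : ℂ)) *
            ∑ p ∈ Finset.Icc 2 (Nat.floor α + 1),
              (2 * Complex.I) ^ (-(p : ℤ) - 1) *
                ((dcoef α p * x₀ ^ (α - (p : ℝ)) : ℝ) : ℂ) +
          (2 * Complex.I) ^ (-(Nat.floor α : ℤ) - 2) *
            ∫ y in Ioi x₀, Complex.exp (-2 * Complex.I * (y : ℂ)) *
              ((dcoef α (Nat.floor α + 2) *
                  y ^ (α - ((Nat.floor α : ℝ) + 2)) : ℝ) : ℂ)))) := by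
  have hα0 : 0 ≤ α := by linarith
  set n := Nat.floor α with hn
  obtain ⟨G, H, hG, hH, hr⟩ := exists_riccati_approx α n
  have hr' : riccati α (MvPolynomial.X 1 ^ 2 * ((1 - MvPolynomial.X 0 ^ 2) * H)) =
      MvPolynomial.X 0 * (MvPolynomial.X 1 ^ 2 *
        ((1 - MvPolynomial.X 0 ^ 2) * (MvPolynomial.X 1 ^ n * G))) := by
    rw [← mul_assoc, mul_comm (MvPolynomial.X 1 ^ 2), hr]
    ring
  set r := (1 - MvPolynomial.X 0 ^ 2) * H
  set R := (1 - MvPolynomial.X 0 ^ 2) * (MvPolynomial.X 1 ^ n * G)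
  obtain ⟨C, hC0, hC⟩ := exists_profEval_bound α hx₀ (MvPolynomial.X 1 ^ 2 * r - 1)
  obtain ⟨K, hK0, hK⟩ := exists_profEval_bound α hx₀ G
  have hI := tendsto_Mtail (α := α) hx₀
  have hI1 : ∀ᶠ θ in 𝓝[>] (0:ℝ), Mtail α θ x₀ ≤ 1 := hI.eventually_le_const one_pos
  have hCI : ∀ᶠ θ in 𝓝[>] (0:ℝ), C * Mtail α θ x₀ ≤ 1 := by
    have := hI.const_mul C
    rw [mul_zero] at this
    exact this.eventually_le_const one_pos
  have hΨ : ∀ᶠ θ in 𝓝[>] (0:ℝ), ∃ Ψ : ℝ → ℂ, ContinuousOn Ψ (Ici x₀) ∧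
      (∀ y ∈ Ici x₀, ‖Ψ y - Complex.exp (-2 * Complex.I * (phase α θ y : ℂ))‖ ≤
        (2 * C + 1) * Mtail α θ x₀) ∧
      Rf θ = -(∫ y in Ioi x₀, Ψ y * profEval α θ (MvPolynomial.X 1 ^ 2 * R) y) -
        profEval α θ (MvPolynomial.X 1 ^ 2 * r) x₀ *
          Complex.exp (-2 * Complex.I * (phase α θ x₀ : ℂ)) := by
    filter_upwards [hRf, hI1, hCI, self_mem_nhdsWithin] with θ ⟨S, hS, hRS⟩ h1 h2 hθ
    rw [hRS]
    exact hS.exists_reflection_formula hα0 hx₀ hθ h1 hr' (fun y hy => hC θ hθ y hy) h2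
  obtain ⟨Ψ, hΨ⟩ := hΨ.choice
  have hexp : ∀ y, 0 < y → Tendsto (fun θ => Complex.exp (-2 * Complex.I * (phase α θ y : ℂ)))
      (𝓝[>] 0) (𝓝 (Complex.exp (-2 * Complex.I * (y : ℂ)))) := fun y hy =>
    ((by fun_prop : Continuous fun t : ℝ => Complex.exp (-2 * Complex.I * (t : ℂ))).tendsto y).comp
      (tendsto_phase hα0 hy)
  have hΨlim : ∀ y ∈ Ici x₀, Tendsto (fun θ => Ψ θ y) (𝓝[>] 0)
      (𝓝 (Complex.exp (-2 * Complex.I * (y : ℂ)))) := by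
    intro y hy
    have h0 : Tendsto (fun θ => (2 * C + 1) * Mtail α θ x₀) (𝓝[>] 0) (𝓝 0) := by
      simpa using hI.const_mul (2 * C + 1)
    have h1 : Tendsto (fun θ => Ψ θ y - Complex.exp (-2 * Complex.I * (phase α θ y : ℂ)))
        (𝓝[>] 0) (𝓝 0) := by
      refine squeeze_zero_norm' ?_ h0
      filter_upwards [hΨ] with θ hθ using hθ.2.1 y hy
    simpa using h1.add (hexp y (hx₀.trans_le hy))
  have hRform : ∀ (θ y : ℝ), profEval α θ (MvPolynomial.X 1 ^ 2 * R) y =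
      profEval α θ ((1 - MvPolynomial.X 0 ^ 2) * (MvPolynomial.X 1 ^ (n + 2) * G)) y := by
    intro θ y
    congr 1
    ring
  have hrform : ∀ θ : ℝ, profEval α θ (MvPolynomial.X 1 ^ 2 * r) x₀ =
      profEval α θ ((1 - MvPolynomial.X 0 ^ 2) * (MvPolynomial.X 1 ^ 2 * H)) x₀ := by
    intro θ
    congr 1
    ring
  have hint : Tendsto (fun θ : ℝ => ∫ y in Ioi x₀,
        Ψ θ y * (profEval α θ (MvPolynomial.X 1 ^ 2 * R) y / (θ : ℂ))) (𝓝[>] 0)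
      (𝓝 (∫ y in Ioi x₀, Complex.exp (-2 * Complex.I * (y : ℂ)) *
        (((y ^ α : ℝ) : ℂ) * MvPolynomial.eval ![1, ((y⁻¹ : ℝ) : ℂ)]
          (MvPolynomial.X 1 ^ (n + 2) * G)))) := by
    refine tendsto_integral_filter_of_dominated_convergence
      (fun y => (2 * C + 2) * (y ^ (α - ((n + 2 : ℕ) : ℝ)) * K)) ?_ ?_ ?_ ?_
    · filter_upwards [hΨ, self_mem_nhdsWithin] with θ hθ hθ0
      refine ContinuousOn.aestronglyMeasurable ?_ measurableSet_Ioi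
      exact (hθ.1.mono Ioi_subset_Ici_self).mul
        (((continuousOn_profEval hθ0 _).mono (Ioi_subset_Ioi hx₀.le)).div_const _)
    · filter_upwards [hΨ, self_mem_nhdsWithin, hI1] with θ hθ hθ0 hθI
      refine (ae_restrict_iff' measurableSet_Ioi).2 (.of_forall fun y hy => ?_)
      have hy0 : 0 < y := hx₀.trans hy
      have hθp : 0 < θ := hθ0
      have h1 : ‖Ψ θ y‖ ≤ 2 * C + 2 := by
        have : Ψ θ y = (Ψ θ y - Complex.exp (-2 * Complex.I * (phase α θ y : ℂ))) +
          Complex.exp (-2 * Complex.I * (phase α θ y : ℂ)) := by ring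
        rw [this]
        refine (norm_add_le_of_le (hθ.2.1 y (Ioi_subset_Ici_self hy))
          (norm_exp_neg_two_I_mul _).le).trans ?_
        nlinarith
      have h2 : ‖profEval α θ (MvPolynomial.X 1 ^ 2 * R) y / (θ : ℂ)‖ ≤
          y ^ (α - ((n + 2 : ℕ) : ℝ)) * K := by
        rw [norm_div, hRform, norm_profEval_one_sub_sq_mul hθp, norm_profEval_X1_pow_mul _ _ hy0,
          Complex.norm_real, Real.norm_of_nonneg hθp.le, div_le_iff₀ hθp,
          rpow_sub_natCast_eq hy0]
        have hyα := Real.rpow_nonneg hy0.le α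
        calc (1 - spd α θ y ^ 2) * (y⁻¹ ^ (n + 2) * ‖profEval α θ G y‖)
            ≤ (θ * y ^ α) * (y⁻¹ ^ (n + 2) * K) := by
              refine mul_le_mul (one_sub_spd_sq_le hθp hy0) ?_ (by positivity) (by positivity)
              exact mul_le_mul_of_nonneg_left (hK θ hθp y (le_of_lt hy)) (by positivity)
          _ = y ^ α * y⁻¹ ^ (n + 2) * K * θ := by ring
      rw [norm_mul]
      exact mul_le_mul h1 h2 (norm_nonneg _) (by positivity)
    · refine ((integrableOn_Ioi_rpow_of_lt ?_ hx₀).mul_const K).const_mul (2 * C + 2)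
      have := Nat.lt_floor_add_one α
      push_cast
      rw [← hn] at this
      linarith
    · refine (ae_restrict_iff' measurableSet_Ioi).2 (.of_forall fun y hy => ?_)
      refine (hΨlim y (Ioi_subset_Ici_self hy)).mul ?_
      simp only [hRform]
      exact tendsto_profEval_div _ (hx₀.trans hy)
  have hbdry := (tendsto_profEval_div (α := α) (MvPolynomial.X 1 ^ 2 * H) hx₀).mul (hexp x₀ hx₀)
  have hlim := hint.neg.sub hbdry
  have hcongr : (fun θ : ℝ => Rf θ / (θ : ℂ)) =ᶠ[𝓝[>] 0] fun θ =>
      -(∫ y in Ioi x₀, Ψ θ y * (profEval α θ (MvPolynomial.X 1 ^ 2 * R) y / (θ : ℂ))) -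
        profEval α θ ((1 - MvPolynomial.X 0 ^ 2) * (MvPolynomial.X 1 ^ 2 * H)) x₀ / (θ : ℂ) *
          Complex.exp (-2 * Complex.I * (phase α θ x₀ : ℂ)) := by
    filter_upwards [hΨ] with θ hθ
    rw [hθ.2.2, hrform]
    simp only [← mul_div_assoc]
    rw [integral_div]
    ring
  refine (hlim.congr' hcongr.symm).trans (le_of_eq (congrArg 𝓝 ?_))
  have hb : ((x₀ ^ α : ℝ) : ℂ) * MvPolynomial.eval ![1, ((x₀⁻¹ : ℝ) : ℂ)]
      (MvPolynomial.X 1 ^ 2 * H) = -((2 * Complex.I)⁻¹ *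
        ∑ p ∈ Finset.Icc 2 (n + 1), (2 * Complex.I) ^ (-(p : ℤ) - 1) *
          ((dcoef α p * x₀ ^ (α - (p : ℝ)) : ℝ) : ℂ)) := by
    have hsum : ∀ f : ℕ → ℂ, ∑ p ∈ Finset.Icc 2 (n + 1), f p = ∑ j ∈ Finset.range n, f (j + 2) := by
      intro f
      rw [← Finset.Ico_succ_right_eq_Icc, Finset.sum_Ico_eq_sum_range]
      refine Finset.sum_congr (by simp) fun j _ => by rw [add_comm]
    rw [hsum, map_mul, eval_one_eq_of_dvd_sub hH, Finset.mul_sum, map_sum, Finset.mul_sum,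
      Finset.mul_sum, ← Finset.sum_neg_distrib]
    refine Finset.sum_congr rfl fun j _ => ?_
    rw [two_I_zpow (j + 3) _ (by push_cast; ring), rpow_sub_natCast_eq hx₀]
    simp only [map_mul, map_pow, MvPolynomial.eval_C, MvPolynomial.eval_X, Matrix.cons_val_one,
      Matrix.cons_val_zero]
    rw [show j + 4 = (j + 3) + 1 by ring, pow_succ (2 * Complex.I) (j + 3), mul_inv]
    push_cast
    ring
  have hi : (∫ y in Ioi x₀, Complex.exp (-2 * Complex.I * (y : ℂ)) *
        (((y ^ α : ℝ) : ℂ) * MvPolynomial.eval ![1, ((y⁻¹ : ℝ) : ℂ)]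
          (MvPolynomial.X 1 ^ (n + 2) * G))) =
      -((2 * Complex.I)⁻¹ * ((2 * Complex.I) ^ (-(n : ℤ) - 2) *
        ∫ y in Ioi x₀, Complex.exp (-2 * Complex.I * (y : ℂ)) *
          ((dcoef α (n + 2) * y ^ (α - ((n : ℝ) + 2)) : ℝ) : ℂ))) := by
    rw [← mul_assoc, ← neg_mul, ← integral_const_mul]
    refine setIntegral_congr_fun measurableSet_Ioi fun y hy => ?_
    have hcast : ((n : ℝ) + 2) = ((n + 2 : ℕ) : ℝ) := by push_cast; ring
    rw [hcast, rpow_sub_natCast_eq (hx₀.trans hy), map_mul, eval_one_eq_of_dvd_sub hG,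
      two_I_zpow (n + 2) _ (by push_cast; ring)]
    simp only [map_pow, MvPolynomial.eval_C, MvPolynomial.eval_X, Matrix.cons_val_one,
      Matrix.cons_val_zero]
    rw [pow_succ (2 * Complex.I) (n + 2), mul_inv]
    push_cast
    ring
  rw [hb, hi]
  ring
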